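/- Let N be a positive integer, χ a Dirichlet character mod N, f ∈ S_k(Γ_0(N), χ) and d ∈ ℕ. Then [Γ_0(N):Γ_0(Nd)] · (f|_k V_d)|_k tr_N^{Nd} = d^{-(k-1)} · f|_k T_N^*(d, 1). -/

import Mathlib

open scoped MatrixGroups ModularForm ComplexConjugate Manifold
open UpperHalfPlane MeasureTheory CongruenceSubgroup Complex

noncomputable section
set_option synthInstance.maxHeartbeats 400000
set_option maxHeartbeats 1000000

instance : MeasurableSpace ℍ := borel ℍ

/-- The measure on the upper half plane induced from Lebesgue measure on `ℂ`
(i.e. `dx dy`). -/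
def hMeasure : Measure ℍ := Measure.comap (fun z : ℍ => (z : ℂ)) volume

/-- The Petersson product of weight `k` at level `N`, computed over a subset `F ⊆ ℍ`
(intended to be a fundamental domain for `Γ₀(N)`), with the normalization
`1/[SL(2,ℤ) : Γ₀(N)] ∫_F f(z) conj (g z) y^(k-2) dx dy`. -/
def pet (N : ℕ) (k : ℤ) (F : Set ℍ) (f g : ℍ → ℂ) : ℂ :=
  ((Gamma0 N).index : ℂ)⁻¹ *
    ∫ z in F, f z * conj (g z) * ((z.im : ℂ)) ^ (k - 2) ∂hMeasure

/-- `f` is a modular form of weight `k` for `Γ₀(Γlevel)` with character induced by the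
Dirichlet character `χ` mod `N` (where `N ∣ Γlevel`). -/
def IsModularFormChar (Γlevel N : ℕ) (χ : DirichletCharacter ℂ N) (k : ℤ)
    (f : ℍ → ℂ) : Prop :=
  MDifferentiable 𝓘(ℂ) 𝓘(ℂ) f ∧
  (∀ γ : SL(2, ℤ), γ ∈ Gamma0 Γlevel → f ∣[k] γ = χ (((γ 1 1 : ℤ) : ZMod N)) • f) ∧
  (∀ A : SL(2, ℤ), IsBoundedAtImInfty (f ∣[k] A))

/-- `f` is a cusp form of weight `k` for `Γ₀(Γlevel)` with character induced by the
Dirichlet character `χ` mod `N` (where `N ∣ Γlevel`). -/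
def IsCuspFormChar (Γlevel N : ℕ) (χ : DirichletCharacter ℂ N) (k : ℤ)
    (f : ℍ → ℂ) : Prop :=
  MDifferentiable 𝓘(ℂ) 𝓘(ℂ) f ∧
  (∀ γ : SL(2, ℤ), γ ∈ Gamma0 Γlevel → f ∣[k] γ = χ (((γ 1 1 : ℤ) : ZMod N)) • f) ∧
  (∀ A : SL(2, ℤ), IsZeroAtImInfty (f ∣[k] A))

/-- `α : ι → SL(2,ℤ)` is a system of representatives for the right cosets
`Γ₀(M) \ Γ₀(N)`, i.e. `Γ₀(N) = ⊔ᵢ Γ₀(M) αᵢ` (disjoint union). -/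
def IsTraceReps (N M : ℕ) {ι : Type} (α : ι → SL(2, ℤ)) : Prop :=
  (∀ i, α i ∈ Gamma0 N) ∧
  ∀ γ : SL(2, ℤ), γ ∈ Gamma0 N → ∃! i, γ * (α i)⁻¹ ∈ Gamma0 M

/-- The trace operator `f ↦ f ∣ₖ tr_N^M` from level `M` to level `N ∣ M`, computed with
respect to a system `α` of coset representatives for `Γ₀(M) \ Γ₀(N)`:
`[Γ₀(N) : Γ₀(M)]⁻¹ ∑ᵢ conj (χ αᵢ) • f ∣[k] αᵢ`. -/
def traceForm (N M : ℕ) (χ : DirichletCharacter ℂ N) (k : ℤ) {ι : Type} [Fintype ι]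
    (α : ι → SL(2, ℤ)) (f : ℍ → ℂ) : ℍ → ℂ :=
  (((Gamma0 M).relIndex (Gamma0 N) : ℂ))⁻¹ •
    ∑ i, conj (χ (((α i 1 1 : ℤ) : ZMod N))) • (f ∣[k] (α i))

/-- The shift operator `V_ℓ`, `(f ∣ V_ℓ)(z) = f (ℓ z)` (junk value for `ℓ = 0`). -/
def Vop (ℓ : ℕ) (f : ℍ → ℂ) : ℍ → ℂ := fun z =>
  if h : 0 < ℓ then
    f ⟨(ℓ : ℂ) * (z : ℂ), by
      have him : ((ℓ : ℂ) * (z : ℂ)).im = (ℓ : ℝ) * (z : ℂ).im := by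
        simp [Complex.mul_im]
      rw [him]
      exact mul_pos (by exact_mod_cast h) z.2⟩
  else f z

/-- The Moebius action of an integral matrix of positive determinant on `ℍ`
(junk value if the determinant is not positive). -/
def actMat (A : Matrix (Fin 2) (Fin 2) ℤ) (z : ℍ) : ℍ :=
  if h : (0 : ℝ) < ((A.map ((↑) : ℤ → ℝ)).det) then
    (((⟨Matrix.GeneralLinearGroup.mkOfDetNeZero (A.map ((↑) : ℤ → ℝ)) (ne_of_gt h),
      by rw [Matrix.mem_glpos]; exact h⟩ : GL(2, ℝ)⁺) • z : ℍ))
  else z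

/-- Membership in the double coset `Γ₀(N) δ Γ₀(N)` of integral matrices. -/
def InDoubleCoset (N : ℕ) (δ X : Matrix (Fin 2) (Fin 2) ℤ) : Prop :=
  ∃ γ ∈ Gamma0 N, ∃ γ' ∈ Gamma0 N,
    X = (γ : Matrix (Fin 2) (Fin 2) ℤ) * δ * (γ' : Matrix (Fin 2) (Fin 2) ℤ)

/-- `β : ι → M₂(ℤ)` is a system of representatives for the right cosets of `Γ₀(N)` in the
double coset `Γ₀(N) δ Γ₀(N)`, i.e. `Γ₀(N) δ Γ₀(N) = ⊔ᵢ Γ₀(N) βᵢ` (disjoint union). -/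
def IsDCReps (N : ℕ) (δ : Matrix (Fin 2) (Fin 2) ℤ) {ι : Type}
    (β : ι → Matrix (Fin 2) (Fin 2) ℤ) : Prop :=
  (∀ i, InDoubleCoset N δ (β i)) ∧
  ∀ X, InDoubleCoset N δ X →
    ∃! i, ∃ γ ∈ Gamma0 N, X = (γ : Matrix (Fin 2) (Fin 2) ℤ) * β i

/-- The Hecke operator `T_N(1, m)` of weight `k` and character `χ`, computed with respect
to a system `β` of coset representatives for `Γ₀(N) \ Γ₀(N) diag(1, m) Γ₀(N)`:
`(f ∣ T_N(1,m))(z) = m^(k-1) ∑ᵢ χ(aᵢ) (cᵢ z + dᵢ)^(-k) f(βᵢ z)`. -/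
def heckeOp (N : ℕ) (χ : DirichletCharacter ℂ N) (k : ℤ) (m : ℕ) {ι : Type} [Fintype ι]
    (β : ι → Matrix (Fin 2) (Fin 2) ℤ) (f : ℍ → ℂ) : ℍ → ℂ := fun z =>
  (m : ℂ) ^ (k - 1) *
    ∑ i, χ ((β i 0 0 : ℤ) : ZMod N) * ((β i 1 0 : ℂ) * (z : ℂ) + (β i 1 1 : ℂ)) ^ (-k) *
      f (actMat (β i) z)

/-- The adjoint Hecke operator `T*_N(m, 1)` of weight `k` and character `χ`, computed with
respect to a system `β` of coset representatives for `Γ₀(N) \ Γ₀(N) diag(m, 1) Γ₀(N)`: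
`(f ∣ T*_N(m,1))(z) = m^(k-1) ∑ᵢ conj (χ(dᵢ)) (cᵢ z + dᵢ)^(-k) f(βᵢ z)`. -/
def heckeStarOp (N : ℕ) (χ : DirichletCharacter ℂ N) (k : ℤ) (m : ℕ) {ι : Type} [Fintype ι]
    (β : ι → Matrix (Fin 2) (Fin 2) ℤ) (f : ℍ → ℂ) : ℍ → ℂ := fun z =>
  (m : ℂ) ^ (k - 1) *
    ∑ i, conj (χ ((β i 1 1 : ℤ) : ZMod N)) *
      ((β i 1 0 : ℂ) * (z : ℂ) + (β i 1 1 : ℂ)) ^ (-k) * f (actMat (β i) z)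

/-- `f` is a primitive form (normalized newform) of weight `k`, level `N` and character `χ`,
with `T_N(1, m)`-eigenvalue `lam m`:  it is a cusp form, has first Fourier coefficient `1`,
is a common eigenform of all Hecke operators `T_N(1, m)`, and is orthogonal to all
oldforms (translates of cusp forms of proper levels `M ∣ N`). -/
def IsPrimitiveForm (N : ℕ) (χ : DirichletCharacter ℂ N) (k : ℤ) (f : ℍ → ℂ)
    (lam : ℕ → ℂ) : Prop :=
  IsCuspFormChar N N χ k f ∧
  (∃ a : ℕ → ℂ, a 0 = 0 ∧ a 1 = 1 ∧
    ∀ z : ℍ, f z = ∑' n : ℕ, a n * Complex.exp (2 * Real.pi * Complex.I * n * z)) ∧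
  (∀ m : ℕ, 0 < m → ∀ (ι : Type) [Fintype ι] (β : ι → Matrix (Fin 2) (Fin 2) ℤ),
    IsDCReps N !![1, 0; 0, (m : ℤ)] β → heckeOp N χ k m β f = lam m • f) ∧
  (∀ M, M ∣ N → M ≠ N → ∀ χ' : DirichletCharacter ℂ M,
    (∀ hMN : M ∣ N, DirichletCharacter.changeLevel hMN χ' = χ) →
    ∀ g : ℍ → ℂ, IsCuspFormChar M M χ' k g → ∀ ℓ : ℕ, 0 < ℓ → ℓ * M ∣ N →
    ∀ F : Set ℍ, IsFundamentalDomain (Gamma0 N) F hMeasure →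
      pet N k F f (Vop ℓ g) = 0)

lemma aux_den_ne (A : Matrix (Fin 2) (Fin 2) ℤ) (hA : 0 < A.det) (z : ℍ) :
    ((A 1 0 : ℂ) * (z : ℂ) + (A 1 1 : ℂ)) ≠ 0 := by
  intro h
  have him := congrArg Complex.im h
  have hre := congrArg Complex.re h
  simp at him hre
  have hz : z.im ≠ 0 := z.im_pos.ne'
  have h0 : A 1 0 = 0 := by
    rcases him with h | h
    · exact h
    · exact absurd h hz
  rw [h0] at hre
  simp at hre
  rw [Matrix.det_fin_two, h0, hre] at hA
  simp at hA

lemma aux_coe_actMat (A : Matrix (Fin 2) (Fin 2) ℤ) (hA : 0 < A.det) (z : ℍ) :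
    ((actMat A z : ℍ) : ℂ) =
      ((A 0 0 : ℂ) * (z : ℂ) + (A 0 1 : ℂ)) / ((A 1 0 : ℂ) * (z : ℂ) + (A 1 1 : ℂ)) := by
  have h : (0 : ℝ) < ((A.map ((↑) : ℤ → ℝ)).det) := by
    rw [Matrix.det_fin_two] at hA ⊢
    simp only [Matrix.map_apply]
    exact_mod_cast hA
  unfold actMat
  rw [dif_pos h]
  change (((Matrix.GeneralLinearGroup.mkOfDetNeZero (A.map ((↑) : ℤ → ℝ)) (ne_of_gt h) :
    GL (Fin 2) ℝ) • z : ℍ) : ℂ) = _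
  rw [UpperHalfPlane.coe_smul_of_det_pos (by exact h)]
  simp [num, denom, Matrix.GeneralLinearGroup.mkOfDetNeZero]

lemma aux_SL_smul (γ : SL(2, ℤ)) (z : ℍ) :
    ((γ • z : ℍ) : ℂ) =
      ((γ 0 0 : ℂ) * (z : ℂ) + (γ 0 1 : ℂ)) / ((γ 1 0 : ℂ) * (z : ℂ) + (γ 1 1 : ℂ)) := by
  rw [UpperHalfPlane.coe_specialLinearGroup_apply]
  simp

lemma aux_slash (f : ℍ → ℂ) (k : ℤ) (γ : SL(2, ℤ)) (z : ℍ) :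
    (f ∣[k] γ) z = f (γ • z) * ((γ 1 0 : ℂ) * (z : ℂ) + (γ 1 1 : ℂ)) ^ (-k) := by
  rw [ModularForm.SL_slash_apply]
  simp [denom]

lemma aux_chi_norm {N : ℕ} (χ : DirichletCharacter ℂ N) {γ : SL(2, ℤ)} (hγ : γ ∈ Gamma0 N) :
    conj (χ ((γ 1 1 : ℤ) : ZMod N)) * χ ((γ 1 1 : ℤ) : ZMod N) = 1 := by
  have hu : IsUnit ((γ 1 1 : ℤ) : ZMod N) := by
    have hdet := γ.det_coe
    rw [Matrix.det_fin_two] at hdet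
    have h2 := congrArg (fun x : ℤ => (x : ZMod N)) hdet
    push_cast at h2
    rw [Gamma0_mem] at hγ
    rw [hγ] at h2
    refine IsUnit.of_mul_eq_one ((γ 0 0 : ℤ) : ZMod N) ?_
    rw [mul_comm]
    simpa using h2
  obtain ⟨u, hu⟩ := hu
  have hn : ‖χ ((γ 1 1 : ℤ) : ZMod N)‖ = 1 := by
    rw [← hu]; exact χ.unit_norm_eq_one u
  rw [mul_comm, Complex.mul_conj, Complex.normSq_eq_norm_sq, hn]
  simp

/-- one summand of the adjoint Hecke operator -/
def auxTerm (N : ℕ) (χ : DirichletCharacter ℂ N) (k : ℤ) (f : ℍ → ℂ)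
    (X : Matrix (Fin 2) (Fin 2) ℤ) (z : ℍ) : ℂ :=
  conj (χ ((X 1 1 : ℤ) : ZMod N)) *
      ((X 1 0 : ℂ) * (z : ℂ) + (X 1 1 : ℂ)) ^ (-k) * f (actMat X z)

lemma aux_term_inv {N : ℕ} {χ : DirichletCharacter ℂ N} {k : ℤ} {f : ℍ → ℂ}
    (hf : ∀ γ : SL(2, ℤ), γ ∈ Gamma0 N → f ∣[k] γ = χ (((γ 1 1 : ℤ) : ZMod N)) • f)
    {B : Matrix (Fin 2) (Fin 2) ℤ} (hB : 0 < B.det)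
    {γ : SL(2, ℤ)} (hγ : γ ∈ Gamma0 N) (z : ℍ) :
    auxTerm N χ k f ((γ : Matrix (Fin 2) (Fin 2) ℤ) * B) z = auxTerm N χ k f B z := by
  have e : ∀ i j, ((γ : Matrix (Fin 2) (Fin 2) ℤ) * B) i j = γ i 0 * B 0 j + γ i 1 * B 1 j := by
    intro i j; rw [Matrix.mul_apply, Fin.sum_univ_two]
  have hdet : 0 < ((γ : Matrix (Fin 2) (Fin 2) ℤ) * B).det := by
    rw [Matrix.det_mul, γ.det_coe, one_mul]; exact hB
  have hDB := aux_den_ne B hB z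
  have hact : actMat ((γ : Matrix (Fin 2) (Fin 2) ℤ) * B) z = γ • actMat B z := by
    apply UpperHalfPlane.ext
    have hD1 := aux_den_ne _ hdet z
    have hD2 := aux_den_ne (γ : Matrix (Fin 2) (Fin 2) ℤ) (by rw [γ.det_coe]; norm_num) (actMat B z)
    rw [aux_SL_smul]
    rw [aux_coe_actMat B hB] at hD2 ⊢
    rw [aux_coe_actMat _ hdet, div_eq_div_iff hD1 hD2]
    simp only [e]
    push_cast
    field_simp
    ring
  have hden : ((((γ : Matrix (Fin 2) (Fin 2) ℤ) * B) 1 0 : ℤ) : ℂ) * (z : ℂ)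
      + ((((γ : Matrix (Fin 2) (Fin 2) ℤ) * B) 1 1 : ℤ) : ℂ)
      = ((γ 1 0 : ℂ) * ((actMat B z : ℍ) : ℂ) + (γ 1 1 : ℂ)) *
        ((B 1 0 : ℂ) * (z : ℂ) + (B 1 1 : ℂ)) := by
    rw [aux_coe_actMat B hB]
    simp only [e]
    push_cast
    field_simp
    ring
  have hchi : ((((γ : Matrix (Fin 2) (Fin 2) ℤ) * B) 1 1 : ℤ) : ZMod N)
      = ((γ 1 1 : ℤ) : ZMod N) * ((B 1 1 : ℤ) : ZMod N) := by
    rw [Gamma0_mem] at hγ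
    rw [e]
    push_cast
    rw [hγ]
    ring
  have hmod := congrFun (hf γ hγ) (actMat B z)
  rw [aux_slash] at hmod
  simp only [Pi.smul_apply, smul_eq_mul] at hmod
  have hn := aux_chi_norm χ hγ
  unfold auxTerm
  rw [hact, hden, hchi, map_mul, map_mul, mul_zpow]
  linear_combination (conj (χ ((γ 1 1 : ℤ) : ZMod N)) * conj (χ ((B 1 1 : ℤ) : ZMod N)) *
    ((B 1 0 : ℂ) * (z : ℂ) + (B 1 1 : ℂ)) ^ (-k)) * hmod +
    (conj (χ ((B 1 1 : ℤ) : ZMod N)) *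
    ((B 1 0 : ℂ) * (z : ℂ) + (B 1 1 : ℂ)) ^ (-k) * f (actMat B z)) * hn

lemma aux_term_delta (N : ℕ) (χ : DirichletCharacter ℂ N) (k : ℤ) (f : ℍ → ℂ)
    (d : ℕ) (hd : 0 < d) (a : SL(2, ℤ)) (z : ℍ) :
    conj (χ (((a 1 1 : ℤ) : ZMod N))) * ((Vop d f) ∣[k] a) z =
      auxTerm N χ k f (!![(d : ℤ), 0; 0, 1] * (a : Matrix (Fin 2) (Fin 2) ℤ)) z := by
  have hdet : 0 < (!![(d : ℤ), 0; 0, 1] * (a : Matrix (Fin 2) (Fin 2) ℤ)).det := by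
    rw [Matrix.det_mul, a.det_coe]; simpa [Matrix.det_fin_two] using hd
  have e0 : ∀ j, (!![(d : ℤ), 0; 0, 1] * (a : Matrix (Fin 2) (Fin 2) ℤ)) 0 j = d * a 0 j := by
    intro j; rw [Matrix.mul_apply, Fin.sum_univ_two]; simp
  have e1 : ∀ j, (!![(d : ℤ), 0; 0, 1] * (a : Matrix (Fin 2) (Fin 2) ℤ)) 1 j = a 1 j := by
    intro j; rw [Matrix.mul_apply, Fin.sum_univ_two]; simp
  have hV : Vop d f (a • z) =
      f (actMat (!![(d : ℤ), 0; 0, 1] * (a : Matrix (Fin 2) (Fin 2) ℤ)) z) := by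
    unfold Vop
    rw [dif_pos hd]
    congr 1
    apply UpperHalfPlane.ext
    rw [aux_coe_actMat _ hdet]
    change (d : ℂ) * ((a • z : ℍ) : ℂ) = _
    rw [aux_SL_smul]
    simp only [e0, e1]
    push_cast
    ring
  rw [aux_slash, hV]
  unfold auxTerm
  simp only [e1]
  ring

/-- if `δ A = g δ` with `g ∈ Γ₀(N)` then `A ∈ Γ₀(N d)`. -/
lemma aux_mem (N d : ℕ) (A g : SL(2, ℤ)) (hg : g ∈ Gamma0 N)
    (h : !![(d : ℤ), 0; 0, 1] * (A : Matrix (Fin 2) (Fin 2) ℤ) =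
      (g : Matrix (Fin 2) (Fin 2) ℤ) * !![(d : ℤ), 0; 0, 1]) : A ∈ Gamma0 (N * d) := by
  have h10 := congrFun (congrFun h 1) 0
  simp [Matrix.mul_apply, Fin.sum_univ_two] at h10
  rw [Gamma0_mem, ZMod.intCast_zmod_eq_zero_iff_dvd] at hg ⊢
  rw [h10]
  push_cast
  exact mul_dvd_mul_right hg _

lemma aux_exists (N d : ℕ) (hd : 0 < d) (A : SL(2, ℤ)) (hA : A ∈ Gamma0 (N * d)) :
    ∃ g ∈ Gamma0 N, !![(d : ℤ), 0; 0, 1] * (A : Matrix (Fin 2) (Fin 2) ℤ) =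
      (g : Matrix (Fin 2) (Fin 2) ℤ) * !![(d : ℤ), 0; 0, 1] := by
  rw [Gamma0_mem, ZMod.intCast_zmod_eq_zero_iff_dvd] at hA
  obtain ⟨c, hc⟩ := hA
  have hdet := A.det_coe
  rw [Matrix.det_fin_two, hc] at hdet
  push_cast at hdet hc
  refine ⟨⟨!![A 0 0, d * A 0 1; N * c, A 1 1], ?_⟩, ?_, ?_⟩
  · rw [Matrix.det_fin_two_of]; linear_combination hdet
  · refine Gamma0_mem.mpr ((ZMod.intCast_zmod_eq_zero_iff_dvd _ _).mpr ?_)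
    exact Dvd.intro c rfl
  · ext i j
    fin_cases i <;> fin_cases j <;> simp [Matrix.mul_apply, Fin.sum_univ_two, hc] <;> ring

/-- For a cusp form `f` of level `N` and `d ∈ ℕ`:
`[Γ₀(N) : Γ₀(Nd)] • (f ∣ V_d) ∣ tr_N^{Nd} = d^{-(k-1)} • f ∣ T*_N(d, 1)`. -/
theorem trace_of_shift_eq_heckeStar (N : ℕ) (hN : 0 < N)
    (χ : DirichletCharacter ℂ N) (k : ℤ) (f : ℍ → ℂ)
    (hf : IsCuspFormChar N N χ k f) (d : ℕ) (hd : 0 < d)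
    (ι : Type) [Fintype ι] (α : ι → SL(2, ℤ)) (hα : IsTraceReps N (N * d) α)
    (ι' : Type) [Fintype ι'] (β : ι' → Matrix (Fin 2) (Fin 2) ℤ)
    (hβ : IsDCReps N !![(d : ℤ), 0; 0, 1] β) :
    ((Gamma0 (N * d)).relIndex (Gamma0 N) : ℂ) • traceForm N (N * d) χ k α (Vop d f)
      = ((d : ℂ) ^ (k - 1))⁻¹ • heckeStarOp N χ k d β f := by
  classical
  have hNd : NeZero (N * d) := ⟨(Nat.mul_pos hN hd).ne'⟩
  have hidx : ((Gamma0 (N * d)).relIndex (Gamma0 N) : ℂ) ≠ 0 := by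
    have h1 : (Gamma0 (N * d)).FiniteIndex := inferInstance
    have h2 : (Gamma0 (N * d)).relIndex (Gamma0 N) ≠ 0 :=
      fun h => h1.index_ne_zero (Subgroup.index_eq_zero_of_relIndex_eq_zero h)
    exact_mod_cast h2
  have hdk : ((d : ℂ) ^ (k - 1)) ≠ 0 := zpow_ne_zero _ (by exact_mod_cast hd.ne')
  have hin : ∀ i, InDoubleCoset N !![(d : ℤ), 0; 0, 1]
      (!![(d : ℤ), 0; 0, 1] * (α i : Matrix (Fin 2) (Fin 2) ℤ)) := fun i =>
    ⟨1, one_mem _, α i, hα.1 i, by simp⟩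
  choose s hs hsu using fun i => hβ.2 _ (hin i)
  choose g hg hge using hs
  have hdetβ : ∀ j, 0 < (β j).det := by
    intro j
    obtain ⟨γ, -, γ', -, h⟩ := hβ.1 j
    rw [h, Matrix.det_mul, Matrix.det_mul, γ.det_coe, γ'.det_coe]
    simpa [Matrix.det_fin_two] using hd
  have hcancel : ∀ (γ : SL(2, ℤ)) (X : Matrix (Fin 2) (Fin 2) ℤ),
      ((γ⁻¹ : SL(2, ℤ)) : Matrix (Fin 2) (Fin 2) ℤ) * ((γ : Matrix (Fin 2) (Fin 2) ℤ) * X) = X := by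
    intro γ X
    rw [← Matrix.mul_assoc, ← Matrix.SpecialLinearGroup.coe_mul]
    simp
  have hcancel' : ∀ (γ : SL(2, ℤ)),
      (γ : Matrix (Fin 2) (Fin 2) ℤ) * ((γ⁻¹ : SL(2, ℤ)) : Matrix (Fin 2) (Fin 2) ℤ) = 1 := by
    intro γ
    rw [← Matrix.SpecialLinearGroup.coe_mul]
    simp
  have hbij : Function.Bijective s := by
    constructor
    · intro i j hij
      have hj : β (s i) = (((g j)⁻¹ : SL(2, ℤ)) : Matrix (Fin 2) (Fin 2) ℤ) *
          (!![(d : ℤ), 0; 0, 1] * (α j : Matrix (Fin 2) (Fin 2) ℤ)) := by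
        rw [hge j, hcancel, hij]
      have hmem : α i * (α j)⁻¹ ∈ Gamma0 (N * d) := by
        refine aux_mem N d _ (g i * (g j)⁻¹) (mul_mem (hg i) (inv_mem (hg j))) ?_
        rw [Matrix.SpecialLinearGroup.coe_mul, ← Matrix.mul_assoc, hge i, hj,
          Matrix.SpecialLinearGroup.coe_mul]
        simp only [Matrix.mul_assoc]
        rw [hcancel', Matrix.mul_one]
      exact (hα.2 (α i) (hα.1 i)).unique (by simp) hmem
    · intro j
      obtain ⟨γ, hγ, γ', hγ', h⟩ := hβ.1 j
      obtain ⟨i, hi, -⟩ := hα.2 γ' hγ'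
      obtain ⟨g', hg', hge'⟩ := aux_exists N d hd _ hi
      refine ⟨i, (hsu i j ⟨(γ * g')⁻¹, inv_mem (mul_mem hγ hg'), ?_⟩).symm⟩
      have : β j = ((γ * g' : SL(2, ℤ)) : Matrix (Fin 2) (Fin 2) ℤ) *
          (!![(d : ℤ), 0; 0, 1] * (α i : Matrix (Fin 2) (Fin 2) ℤ)) := by
        have h3 : (γ' : Matrix (Fin 2) (Fin 2) ℤ) =
            ((γ' * (α i)⁻¹ : SL(2, ℤ)) : Matrix (Fin 2) (Fin 2) ℤ) *
              (α i : Matrix (Fin 2) (Fin 2) ℤ) := by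
          rw [← Matrix.SpecialLinearGroup.coe_mul]; simp
        rw [h, h3, Matrix.mul_assoc, ← Matrix.mul_assoc !![(d : ℤ), 0; 0, 1], hge',
          Matrix.SpecialLinearGroup.coe_mul γ g']
        simp only [Matrix.mul_assoc]
      rw [this, hcancel]
  ext z
  unfold traceForm heckeStarOp
  rw [smul_smul, mul_inv_cancel₀ hidx, one_smul]
  simp only [Pi.smul_apply, smul_eq_mul, Finset.sum_apply]
  rw [← mul_assoc, inv_mul_cancel₀ hdk, one_mul]
  refine Fintype.sum_bijective s hbij _ _ fun i => ?_
  rw [aux_term_delta N χ k f d hd (α i) z, hge i]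
  exact aux_term_inv hf.2.1 (hdetβ _) (hg i) z

end
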